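/- Let (G,L) be a non-degenerate R-network over a commutative ring R, and let 𝔞 be an ideal of R. Then Tor₁^R(Υ(G,L), R/𝔞) = 0 if and only if the quotient network (G, L/𝔞) over R/𝔞 (obtained by reducing all edge weights and diagonal terms modulo 𝔞) is non-degenerate. -/

import Mathlib

open Finsupp

/-- A graph with boundary (`∂`-graph) together with a generalized Laplacian datum over `R`:
oriented edges with a fixed-point-free reversal involution, local finiteness,
a set of boundary vertices, symmetric edge weights `w` and diagonal perturbation `d`. -/
structure DNetwork (R : Type) [CommRing R] where
  V : Type
  E : Type
  src : E → V
  rev : E → E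
  rev_rev : ∀ e, rev (rev e) = e
  rev_ne : ∀ e, rev e ≠ e
  finE : ∀ x : V, Fintype {e : E // src e = x}
  boundary : Set V
  w : E → R
  w_rev : ∀ e, w (rev e) = w e
  d : V → R

namespace DNetwork

variable {R : Type} [CommRing R] (N : DNetwork R)

/-- The endpoint of an oriented edge. -/
def tgt (e : N.E) : N.V := N.src (N.rev e)

/-- The generalized Laplacian evaluated at the vertex `x`, as a linear functional on
`M`-valued functions: `Lu(x) = d(x) u(x) + ∑_{e : e₊ = x} w(e) (u(x) - u(e₋))`. -/
noncomputable def lapAt {M : Type} [AddCommGroup M] [Module R M] (x : N.V) :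
    (N.V → M) →ₗ[R] M :=
  letI := N.finE x
  N.d x • (LinearMap.proj x : (N.V → M) →ₗ[R] M) +
    ∑ e : {e : N.E // N.src e = x},
      N.w e.1 • ((LinearMap.proj x : (N.V → M) →ₗ[R] M) - LinearMap.proj (N.tgt e.1))

/-- The generalized Laplacian applied to the basis chain at the vertex `x`. -/
noncomputable def lapSingle (x : N.V) : N.V →₀ R :=
  letI := N.finE x
  N.d x • Finsupp.single x 1 +
    ∑ e : {e : N.E // N.src e = x},
      N.w e.1 • (Finsupp.single x 1 - Finsupp.single (N.tgt e.1) 1)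

/-- The generalized Laplacian as a linear endomorphism of the module `RV` of `0`-chains. -/
noncomputable def chainLap : (N.V →₀ R) →ₗ[R] (N.V →₀ R) :=
  Finsupp.lsum R fun x => LinearMap.toSpanSingleton R _ (N.lapSingle x)

/-- The set of interior vertices. -/
def interior : Set N.V := N.boundaryᶜ

/-- The submodule `L(RV°)` of `RV`. -/
noncomputable def lapImage : Submodule R (N.V →₀ R) :=
  Submodule.map N.chainLap (Finsupp.supported R R N.interior)

/-- The fundamental module `Υ(G,L) = RV / L(RV°)`. -/
abbrev Upsilon := (N.V →₀ R) ⧸ N.lapImage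

/-- The submodule of `M`-valued harmonic functions `U(G,L,M)`. -/
noncomputable def harmonic (M : Type) [AddCommGroup M] [Module R M] :
    Submodule R (N.V → M) :=
  ⨅ x ∈ N.interior, LinearMap.ker (N.lapAt (M := M) x)

/-- The module `U₀(G,L,M)` of finitely supported `M`-valued functions `u` with
`u = 0` on the boundary and `Lu ≡ 0` everywhere. -/
noncomputable def U0 (M : Type) [AddCommGroup M] [Module R M] :
    Submodule R (N.V →₀ M) :=
  (⨅ x ∈ N.boundary, LinearMap.ker (Finsupp.lapply (M := M) (R := R) x)) ⊓
    (⨅ x : N.V, LinearMap.ker ((N.lapAt (M := M) x).comp Finsupp.lcoeFun))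

/-- Adjacency via an oriented edge. -/
def Adj (x y : N.V) : Prop := ∃ e : N.E, N.src e = x ∧ N.tgt e = y

/-- Connectivity of the underlying graph. -/
def Connected : Prop := ∀ x y : N.V, Relation.ReflTransGen N.Adj x y

end DNetwork

/-- The quotient network `(G, L/𝔞)` over `R/𝔞`, obtained by reducing all edge weights and
diagonal terms modulo the ideal `𝔞`. -/
noncomputable def DNetwork.quotNet {R : Type} [CommRing R] (N : DNetwork R) (I : Ideal R) :
    DNetwork (R ⧸ I) where
  V := N.V
  E := N.E
  src := N.src
  rev := N.rev
  rev_rev := N.rev_rev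
  rev_ne := N.rev_ne
  finE := N.finE
  boundary := N.boundary
  w := fun e => Ideal.Quotient.mk I (N.w e)
  w_rev := fun e => by show Ideal.Quotient.mk I (N.w (N.rev e)) = _; rw [N.w_rev]
  d := fun x => Ideal.Quotient.mk I (N.d x)

open CategoryTheory

section TensorDiagram

open TensorProduct

variable {R : Type*} [CommRing R] {K F Q P₂ P₁ P₀ Y : Type*}
  [AddCommGroup K] [Module R K] [AddCommGroup F] [Module R F] [AddCommGroup Q] [Module R Q]
  [AddCommGroup P₂] [Module R P₂] [AddCommGroup P₁] [Module R P₁]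
  [AddCommGroup P₀] [Module R P₀] [AddCommGroup Y] [Module R Y]

theorem LinearMap.lTensor_rTensor_apply_comm (f : K →ₗ[R] F) (g : P₁ →ₗ[R] P₀) (x : K ⊗[R] P₁) :
    g.lTensor F (f.rTensor P₁ x) = f.rTensor P₀ (g.lTensor K x) := by
  rw [← LinearMap.comp_apply, ← LinearMap.comp_apply, LinearMap.lTensor_comp_rTensor,
    LinearMap.rTensor_comp_lTensor]

/-- The diagram chase comparing the two ways of computing `Tor₁(Q, Y)`: from a presentation
`K → F → Q` with `F` flat, and from the beginning `P₂ → P₁ → P₀ → Y` of a flat resolution. -/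
theorem LinearMap.exact_lTensor_iff_injective_rTensor [Module.Flat R F] [Module.Flat R P₀]
    {f : K →ₗ[R] F} {g : F →ₗ[R] Q} (hf : Function.Injective f) (hfg : Function.Exact f g)
    (hg : Function.Surjective g)
    {d₂ : P₂ →ₗ[R] P₁} {d₁ : P₁ →ₗ[R] P₀} {p : P₀ →ₗ[R] Y} (h₂₁ : Function.Exact d₂ d₁)
    (h₁ : Function.Exact d₁ p) (hp : Function.Surjective p) :
    Function.Exact (d₂.lTensor Q) (d₁.lTensor Q) ↔ Function.Injective (f.rTensor Y) := by
  have hi₀ : Function.Injective (f.rTensor P₀) :=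
    Module.Flat.rTensor_preserves_injective_linearMap f hf
  have hK₁ := lTensor_exact K h₁ hp
  have hF₁ := lTensor_exact F h₁ hp
  have hF₂ := Module.Flat.lTensor_exact F h₂₁
  have hc₁ := rTensor_exact P₁ hfg hg
  have hc₀ := rTensor_exact P₀ hfg hg
  constructor
  · intro hQ
    rw [injective_iff_map_eq_zero]
    intro y hy
    obtain ⟨k₀, rfl⟩ := LinearMap.lTensor_surjective K hp y
    rw [← LinearMap.lTensor_rTensor_apply_comm] at hy
    obtain ⟨f₁, hf₁⟩ := (hF₁ _).1 hy
    obtain ⟨u, hu⟩ := (hQ (g.rTensor P₁ f₁)).1 <| by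
      rw [LinearMap.lTensor_rTensor_apply_comm, hf₁]; exact hc₀.apply_apply_eq_zero k₀
    obtain ⟨f₂, rfl⟩ := LinearMap.rTensor_surjective P₂ hg u
    obtain ⟨k₁, hk₁⟩ := (hc₁ (f₁ - d₂.lTensor F f₂)).1 <| by
      rw [map_sub, ← LinearMap.lTensor_rTensor_apply_comm, hu, sub_self]
    have : k₀ = d₁.lTensor K k₁ := hi₀ <| by
      rw [← LinearMap.lTensor_rTensor_apply_comm, hk₁, map_sub, hf₁,
        hF₂.apply_apply_eq_zero, sub_zero]
    rw [this, hK₁.apply_apply_eq_zero]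
  · intro hY u
    constructor
    · intro hu
      obtain ⟨f₁, rfl⟩ := LinearMap.rTensor_surjective P₁ hg u
      rw [LinearMap.lTensor_rTensor_apply_comm] at hu
      obtain ⟨k₀, hk₀⟩ := (hc₀ _).1 hu
      obtain ⟨k₁, rfl⟩ := (hK₁ k₀).1 <| hY <| by
        rw [← LinearMap.lTensor_rTensor_apply_comm, hk₀, hF₁.apply_apply_eq_zero, map_zero]
      obtain ⟨f₂, hf₂⟩ := (hF₂ (f₁ - f.rTensor P₁ k₁)).1 <| by
        rw [map_sub, LinearMap.lTensor_rTensor_apply_comm, hk₀, sub_self]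
      exact ⟨g.rTensor P₂ f₂, by
        rw [LinearMap.lTensor_rTensor_apply_comm, hf₂, map_sub, hc₁.apply_apply_eq_zero, sub_zero]⟩
    · rintro ⟨v, rfl⟩
      rw [← LinearMap.comp_apply, ← LinearMap.lTensor_comp, h₂₁.linearMap_comp_eq_zero,
        LinearMap.lTensor_zero, LinearMap.zero_apply]

end TensorDiagram

universe u v w

/-- If `0 → K → F → Q → 0` is exact with `F` flat, then `Tor₁(Q, Y)` vanishes if and only if
`K ⊗ Y → F ⊗ Y` is injective. -/
theorem ModuleCat.subsingleton_tor_one_iff_injective_rTensor {R : Type u} [CommRing R]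
    {K : Type v} {F : Type w} {Q Y : Type u} [AddCommGroup K] [Module R K]
    [AddCommGroup F] [Module R F] [Module.Flat R F] [AddCommGroup Q] [Module R Q] [AddCommGroup Y] [Module R Y]
    {f : K →ₗ[R] F} {g : F →ₗ[R] Q} (hf : Function.Injective f) (hfg : Function.Exact f g)
    (hg : Function.Surjective g) :
    Subsingleton (((Tor (ModuleCat R) 1).obj (ModuleCat.of R Q)).obj (ModuleCat.of R Y)) ↔
      Function.Injective (f.rTensor Y) := by
  let P := ProjectiveResolution.of (ModuleCat.of R Y)
  have : Module.Projective R (P.complex.X 0) :=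
    (IsProjective.iff_projective (P.complex.X 0)).2 (P.projective 0)
  have h₂₁ := (ShortComplex.ShortExact.moduleCat_exact_iff_function_exact _).1 (P.exact_succ 0)
  have h₁ := (ShortComplex.ShortExact.moduleCat_exact_iff_function_exact _).1 P.exact₀
  have hp : Function.Surjective (P.π.f 0) := (ModuleCat.epi_iff_surjective _).1 inferInstance
  refine Iff.trans ?_ (LinearMap.exact_lTensor_iff_injective_rTensor hf hfg hg h₂₁ h₁ hp)
  rw [← ModuleCat.isZero_iff_subsingleton]
  refine (P.isoLeftDerivedObj ((MonoidalCategory.tensoringLeft _).obj (ModuleCat.of R Q))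
    1).isZero_iff.trans ?_
  refine (HomologicalComplex.exactAt_iff_isZero_homology _ _).symm.trans ?_
  rw [HomologicalComplex.exactAt_iff' _ 2 1 0 (by simp) (by simp),
    ShortComplex.ShortExact.moduleCat_exact_iff_function_exact]
  rfl

namespace DNetwork

open TensorProduct

variable {R : Type} [CommRing R] (N : DNetwork R)

/-- The restriction of the generalized Laplacian to chains on the interior vertices. -/
noncomputable def interiorLap : (N.interior →₀ R) →ₗ[R] (N.V →₀ R) :=
  N.chainLap ∘ₗ Finsupp.lmapDomain R R Subtype.val

theorem range_interiorLap : LinearMap.range N.interiorLap = N.lapImage := by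
  rw [interiorLap, LinearMap.range_comp, lapImage]
  congr 1
  rw [Finsupp.range_lmapDomain, Finsupp.supported_eq_span_single]
  congr 1
  ext
  simp

theorem lapAt_apply {M : Type} [AddCommGroup M] [Module R M] (x : N.V) (u : N.V → M) :
    N.lapAt x u = letI := N.finE x
      N.d x • u x + ∑ e : {e : N.E // N.src e = x}, N.w e.1 • (u x - u (N.tgt e.1)) := by
  simp [lapAt]

theorem tgt_rev (e : N.E) : N.tgt (N.rev e) = N.src e := by
  rw [tgt, N.rev_rev]

theorem chainLap_apply (u : N.V →₀ R) (y : N.V) : N.chainLap u y = N.lapAt (M := R) y u := by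
  classical
  suffices h : Finsupp.lapply y ∘ₗ N.chainLap = N.lapAt (M := R) y ∘ₗ Finsupp.lcoeFun from
    LinearMap.congr_fun h u
  ext x
  let := N.finE x
  let := N.finE y
  have key : ∑ e : {e : N.E // N.src e = x}, N.w e.1 * (Finsupp.single (N.tgt e.1) (1 : R)) y =
      ∑ e : {e : N.E // N.src e = y}, N.w e.1 * (Finsupp.single x (1 : R)) (N.tgt e.1) := by
    refine Finset.sum_bij_ne_zero
      (fun e _ he => ⟨N.rev e.1, by
        by_contra h
        exact he (by rw [Finsupp.single_apply, if_neg (by exact h), mul_zero])⟩)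
      (fun _ _ _ => Finset.mem_univ _) ?_ ?_ ?_
    · intro e₁ _ _ e₂ _ _ h
      have h' := congrArg N.rev (Subtype.ext_iff.1 h)
      rw [N.rev_rev, N.rev_rev] at h'
      exact Subtype.ext h'
    · intro e _ he
      have hx : x = N.tgt e.1 := by
        by_contra h
        exact he (by rw [Finsupp.single_apply, if_neg h, mul_zero])
      refine ⟨⟨N.rev e.1, hx.symm⟩, Finset.mem_univ _, ?_, Subtype.ext (N.rev_rev _)⟩
      simpa [N.tgt_rev, N.w_rev, e.2, hx] using he
    · intro e _ he
      have hy : N.tgt e.1 = y := by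
        by_contra h
        exact he (by rw [Finsupp.single_apply, if_neg h, mul_zero])
      simp [N.tgt_rev, N.w_rev, e.2, hy]
  have hx : N.chainLap (Finsupp.single x 1) = N.lapSingle x := by
    simp [chainLap]
  have hl : N.chainLap (Finsupp.single x 1) y =
      N.d x * Finsupp.single x (1 : R) y +
        (∑ e : {e : N.E // N.src e = x}, N.w e.1 * Finsupp.single x (1 : R) y -
          ∑ e : {e : N.E // N.src e = x}, N.w e.1 * (Finsupp.single (N.tgt e.1) (1 : R)) y) := by
    rw [hx, ← Finset.sum_sub_distrib]
    simp only [lapSingle, Finsupp.add_apply, Finsupp.smul_apply, Finsupp.finsetSum_apply,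
      Finsupp.sub_apply, smul_eq_mul, mul_sub]
  have hr : N.lapAt (M := R) y (Finsupp.single x (1 : R)) =
      N.d y * Finsupp.single x (1 : R) y +
        (∑ e : {e : N.E // N.src e = y}, N.w e.1 * Finsupp.single x (1 : R) y -
          ∑ e : {e : N.E // N.src e = y}, N.w e.1 * (Finsupp.single x (1 : R)) (N.tgt e.1)) := by
    rw [lapAt_apply, ← Finset.sum_sub_distrib]
    simp only [smul_eq_mul, mul_sub]
  change N.chainLap (Finsupp.single x 1) y = N.lapAt (M := R) y (Finsupp.single x (1 : R))
  rw [hl, hr, key]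
  by_cases hxy : x = y
  · subst hxy
    rfl
  · simp [hxy]

theorem mem_U0_iff (u : N.V →₀ R) :
    u ∈ N.U0 R ↔ u ∈ Finsupp.supported R R N.interior ∧ N.chainLap u = 0 := by
  rw [Finsupp.mem_supported', Finsupp.ext_iff]
  simp [U0, interior, chainLap_apply, Submodule.mem_iInf, Finsupp.lcoeFun]

theorem U0_eq_bot_iff : N.U0 R = ⊥ ↔ Function.Injective N.interiorLap := by
  rw [injective_iff_map_eq_zero, Submodule.eq_bot_iff]
  have hinj := Finsupp.mapDomain_injective (M := R) (Subtype.val_injective (p := (· ∈ N.interior)))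
  constructor
  · intro h u hu
    refine hinj ((h _ ((N.mem_U0_iff _).2 ⟨?_, hu⟩)).trans Finsupp.mapDomain_zero.symm)
    rw [Finsupp.mem_supported']
    intro x hx
    exact Finsupp.mapDomain_of_notMem_range _ _ (by simpa using hx)
  · intro h u hu
    obtain ⟨hs, hu⟩ := (N.mem_U0_iff u).1 hu
    obtain ⟨v, rfl⟩ := (Finsupp.mem_range_mapDomain_iff _ Subtype.val_injective u).2
      (by simpa using (Finsupp.mem_supported' R u).1 hs)
    rw [h v hu, Finsupp.mapDomain_zero]

theorem quotNet_chainLap_mapRange (I : Ideal R) (u : N.V →₀ R) :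
    (N.quotNet I).chainLap (u.mapRange (Ideal.Quotient.mk I) (map_zero _)) =
      (N.chainLap u).mapRange (Ideal.Quotient.mk I) (map_zero _) := by
  refine Finsupp.ext fun (y : N.V) => ?_
  let := N.finE y
  have h : Ideal.Quotient.mk I (N.chainLap u y) =
      Ideal.Quotient.mk I (N.d y) * Ideal.Quotient.mk I (u y) +
        ∑ e : {e : N.E // N.src e = y}, Ideal.Quotient.mk I (N.w e.1) *
          (Ideal.Quotient.mk I (u y) - Ideal.Quotient.mk I (u (N.tgt e.1))) := by
    rw [chainLap_apply, lapAt_apply, map_add, map_sum]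
    simp only [smul_eq_mul, map_mul, map_sub]
  exact ((N.quotNet I).chainLap_apply _ y).trans <| ((N.quotNet I).lapAt_apply y _).trans h.symm

theorem injective_rTensor_interiorLap_iff (I : Ideal R) :
    Function.Injective (N.interiorLap.rTensor (R ⧸ I)) ↔
      Function.Injective (N.quotNet I).interiorLap := by
  classical
  let a := TensorProduct.finsuppScalarLeft R (R ⧸ I) N.V
  let b := TensorProduct.finsuppScalarLeft R (R ⧸ I) N.interior
  let φ : (N.interior →₀ R ⧸ I) →ₗ[R] (N.V →₀ R ⧸ I) :=
    (N.quotNet I).interiorLap.restrictScalars R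
  have h : a.toLinearMap ∘ₗ N.interiorLap.rTensor (R ⧸ I) = φ ∘ₗ b.toLinearMap := by
    have key (u : N.interior →₀ R) :
        a (N.interiorLap u ⊗ₜ[R] (1 : R ⧸ I)) = φ (b (u ⊗ₜ[R] (1 : R ⧸ I))) := by
      have h1 {ι : Type} [DecidableEq ι] (p : ι →₀ R) :
          TensorProduct.finsuppScalarLeft R (R ⧸ I) ι (p ⊗ₜ[R] (1 : R ⧸ I)) =
            p.mapRange (Ideal.Quotient.mk I) (map_zero _) := by
        ext i
        rw [TensorProduct.finsuppScalarLeft_apply_tmul_apply, Finsupp.mapRange_apply,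
          Algebra.smul_def, mul_one]
        rfl
      simp only [a, b, h1]
      refine (N.quotNet_chainLap_mapRange I _).symm.trans (congrArg (N.quotNet I).chainLap ?_)
      exact (Finsupp.mapDomain_mapRange _ _ _ (map_zero _) (map_add _)).symm
    refine TensorProduct.ext' fun u q => ?_
    obtain ⟨r, rfl⟩ := Ideal.Quotient.mk_surjective q
    have hr : Ideal.Quotient.mk I r = r • (1 : R ⧸ I) := by
      rw [Algebra.smul_def, mul_one]
      rfl
    simp only [LinearMap.comp_apply, LinearMap.rTensor_tmul, LinearEquiv.coe_coe, hr,
      TensorProduct.tmul_smul, map_smul, key]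
  exact (a.injective.of_comp_iff _).symm.trans <|
    (iff_of_eq (congrArg Function.Injective (congrArg DFunLike.coe h))).trans
      (Function.Injective.of_comp_iff' φ b.bijective)

end DNetwork

/-- for a non-degenerate `R`-network, `Tor₁(Υ(G,L), R/𝔞) = 0` iff the quotient
network `(G, L/𝔞)` over `R/𝔞` is non-degenerate. -/
theorem tor_one_quotient_eq_zero_iff_quotNet_nondegenerate
    {R : Type} [CommRing R] (N : DNetwork R)
    (hnd : N.U0 R = ⊥) (I : Ideal R) :
    Subsingleton (((Tor (ModuleCat R) 1).obj (ModuleCat.of R N.Upsilon)).obj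
        (ModuleCat.of R (R ⧸ I))) ↔
      (N.quotNet I).U0 (R ⧸ I) = ⊥ := by
  rw [DNetwork.U0_eq_bot_iff, ← N.injective_rTensor_interiorLap_iff]
  exact ModuleCat.subsingleton_tor_one_iff_injective_rTensor (N.U0_eq_bot_iff.1 hnd)
    (LinearMap.exact_iff.2 (by rw [Submodule.ker_mkQ, N.range_interiorLap]))
    (Submodule.mkQ_surjective N.lapImage)
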